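/- arXiv:2511.12527 — 2 statements merged into one kernel-verified Lean document; each statement's English description precedes it below -/
import Mathlib

section
/- Let n1, n2 ≥ 2 be integers and let x ≠ y be real numbers. Let z1, z2 ∈ ℂ satisfy z1² = x and z2² = y, and assume the pair (z1,z2) is (n1,n2)-independent. Then the rank of K(n1,n2,x,y) equals n1·n2 if n1·n2 is even, and equals n1·n2 − 1 if n1·n2 is odd; in particular, K(n1,n2,x,y) is nonsingular if and only if n1·n2 is even. -/
open Matrix Kronecker

noncomputable section

/-- The modified Kac matrix `𝒦(n,y)`: its 1-based entry `(i,j)` equals `(n-j)·y` if `j = i-1`,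
equals `i` if `j = i+1`, and equals `0` otherwise. -/
def kacM (R : Type*) [CommRing R] (n : ℕ) (y : R) : Matrix (Fin n) (Fin n) R :=
  Matrix.of fun i j =>
    if (i : ℕ) = (j : ℕ) + 1 then ((n - 1 - (j : ℕ) : ℕ) : R) * y
    else if (j : ℕ) = (i : ℕ) + 1 then (((i : ℕ) + 1 : ℕ) : R)
    else 0

/-- The modified Kac matrix of second type `K(n1,n2,x,y)`, indexed by pairs
`(block index, index inside block)`; the pair `(u,v)` (0-based) corresponds to the
1-based position `u·n2 + v + 1`.  Its `n2×n2` blocks `K_{ij}` (1-based) are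
`𝒦(n2,y)` if `i = j`, `(n1-j)·x·I` if `j = i-1`, `i·I` if `j = i+1`, and `0` otherwise. -/
def kac2M (R : Type*) [CommRing R] (n1 n2 : ℕ) (x y : R) :
    Matrix (Fin n1 × Fin n2) (Fin n1 × Fin n2) R :=
  Matrix.of fun p q =>
    if p.1 = q.1 then kacM R n2 y p.2 q.2
    else if (p.1 : ℕ) = (q.1 : ℕ) + 1 then
      (if p.2 = q.2 then ((n1 - 1 - (q.1 : ℕ) : ℕ) : R) * x else 0)
    else if (q.1 : ℕ) = (p.1 : ℕ) + 1 then
      (if p.2 = q.2 then (((p.1 : ℕ) + 1 : ℕ) : R) else 0)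
    else 0

/-- A pair `(z1,z2)` of complex numbers is `(n1,n2)`-independent if, for all
`a1, b1 ∈ 𝒩₁ = {n1-1-2r : 0 ≤ r ≤ n1-1}` and `a2, b2 ∈ 𝒩₂ = {n2-1-2r : 0 ≤ r ≤ n2-1}`,
`(a1-b1)z1 + (a2-b2)z2 = 0` implies `a1 = b1` and `a2 = b2`. -/
def IndepPair (n1 n2 : ℕ) (z1 z2 : ℂ) : Prop :=
  ∀ a1 b1 a2 b2 : ℤ,
    (∃ r : ℕ, r < n1 ∧ a1 = (n1 : ℤ) - 1 - 2 * r) →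
    (∃ r : ℕ, r < n1 ∧ b1 = (n1 : ℤ) - 1 - 2 * r) →
    (∃ r : ℕ, r < n2 ∧ a2 = (n2 : ℤ) - 1 - 2 * r) →
    (∃ r : ℕ, r < n2 ∧ b2 = (n2 : ℤ) - 1 - 2 * r) →
    ((a1 - b1 : ℤ) : ℂ) * z1 + ((a2 - b2 : ℤ) : ℂ) * z2 = 0 →
    a1 = b1 ∧ a2 = b2


open Polynomial in
lemma kac_poly (z : ℂ) (a b : ℕ) :
    (1 - C (z ^ 2) * X ^ 2) * derivative ((1 + C z * X) ^ a * (1 - C z * X) ^ b)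
      + C (((a + b : ℕ) : ℂ) * z ^ 2) * X * ((1 + C z * X) ^ a * (1 - C z * X) ^ b)
    = C (((a : ℂ) - b) * z) * ((1 + C z * X) ^ a * (1 - C z * X) ^ b) := by
  rcases a with _ | a <;> rcases b with _ | b <;>
  simp [derivative_mul, derivative_pow] <;> ring

/-- coefficients of `(1+zX)^a (1-zX)^b`. -/
def kacV (z : ℂ) (a b : ℕ) (i : ℕ) : ℂ :=
  ((1 + Polynomial.C z * Polynomial.X) ^ a * (1 - Polynomial.C z * Polynomial.X) ^ b).coeff i

lemma kacV_zero (z : ℂ) (a b : ℕ) : kacV z a b 0 = 1 := by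
  simp [kacV, Polynomial.coeff_zero_eq_eval_zero]

open Polynomial in
lemma kacV_big (z : ℂ) (a b : ℕ) : kacV z a b (a + b + 1) = 0 := by
  apply coeff_eq_zero_of_natDegree_lt
  have h1 : (1 + C z * X : ℂ[X]).natDegree ≤ 1 := by compute_degree
  have h2 : (1 - C z * X : ℂ[X]).natDegree ≤ 1 := by compute_degree
  have h3 := natDegree_pow_le_of_le a h1
  have h4 := natDegree_pow_le_of_le b h2
  have h5 := natDegree_mul_le_of_le h3 h4
  omega

open Polynomial in
lemma kacV_one (z : ℂ) (a b : ℕ) :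
    kacV z a b 1 = ((a : ℂ) - b) * z * kacV z a b 0 := by
  have h := congrArg (fun p => coeff p 0) (kac_poly z a b)
  unfold kacV
  generalize ((1 + C z * X) ^ a * (1 - C z * X) ^ b : ℂ[X]) = p at *
  simp only [sub_mul, one_mul, mul_assoc, pow_two, coeff_add, coeff_sub, coeff_C_mul,
    coeff_X_mul_zero, coeff_derivative] at h
  simp at h
  linear_combination h

open Polynomial in
lemma kacV_succ (z : ℂ) (a b i : ℕ) :
    ((a + b : ℂ) - i) * z ^ 2 * kacV z a b i + (i + 2) * kacV z a b (i + 2)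
      = ((a : ℂ) - b) * z * kacV z a b (i + 1) := by
  have h := congrArg (fun p => coeff p (i + 1)) (kac_poly z a b)
  unfold kacV
  generalize ((1 + C z * X) ^ a * (1 - C z * X) ^ b : ℂ[X]) = p at *
  have hx : coeff (X * derivative p) i = i * coeff p i := by
    cases i with
    | zero => simp
    | succ j => rw [coeff_X_mul, coeff_derivative]; push_cast; ring
  rw [sub_mul, one_mul, show C (z ^ 2) * X ^ 2 * derivative p
    = C (z ^ 2) * (X * (X * derivative p)) by ring, mul_assoc] at h
  simp only [coeff_add, coeff_sub, coeff_C_mul, coeff_X_mul, coeff_derivative, hx] at h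
  push_cast at h
  linear_combination h

lemma kacM_sum (n : ℕ) (y : ℂ) (v : ℕ → ℂ) (hv : v n = 0) (i : Fin n) :
    ∑ j : Fin n, kacM ℂ n y i j * v j =
      (if (i : ℕ) = 0 then 0 else ((n - i : ℕ) : ℂ) * y * v (i - 1))
        + ((i : ℕ) + 1) * v (i + 1) := by
  have hi := i.2
  have h : ∀ j : Fin n, kacM ℂ n y i j * v j =
      (fun j : ℕ => (if j = (i : ℕ) - 1 then (if (i : ℕ) = 0 then 0 else
          ((n - i : ℕ) : ℂ) * y * v j) else 0)
        + (if j = (i : ℕ) + 1 then ((i : ℕ) + 1) * v j else 0)) (j : ℕ) := by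
    intro j
    simp only [kacM, Matrix.of_apply]
    by_cases h1 : (i : ℕ) = (j : ℕ) + 1
    · have e : n - 1 - (j : ℕ) = n - (i : ℕ) := by omega
      have e1 : (j : ℕ) = (i : ℕ) - 1 := by omega
      have e2 : ¬ (j : ℕ) = (i : ℕ) + 1 := by omega
      have e3 : ¬ (i : ℕ) = 0 := by omega
      rw [if_pos h1, if_pos e1, if_neg e2, if_neg e3, e, add_zero]
    · rw [if_neg h1]
      have e : (if (j : ℕ) = (i : ℕ) - 1 then (if (i : ℕ) = 0 then 0 else
          ((n - i : ℕ) : ℂ) * y * v j) else 0) = 0 := by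
        split_ifs
        · rfl
        · omega
        · rfl
      rw [e, zero_add]
      split_ifs <;> simp
  rw [Finset.sum_congr rfl (fun j _ => h j),
    Fin.sum_univ_eq_sum_range (fun j : ℕ => (if j = (i : ℕ) - 1 then (if (i : ℕ) = 0 then 0 else
          ((n - i : ℕ) : ℂ) * y * v j) else 0)
        + (if j = (i : ℕ) + 1 then ((i : ℕ) + 1) * v j else 0)) n, Finset.sum_add_distrib,
    Finset.sum_ite_eq', Finset.sum_ite_eq']
  congr 1
  · rw [if_pos (Finset.mem_range.2 (by omega))]
  · split_ifs with h3
    · rfl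
    · have : (i : ℕ) + 1 = n := by
        rw [Finset.mem_range] at h3; omega
      rw [this, hv, mul_zero]

lemma kacM_eig (n : ℕ) (y z : ℂ) (hz : z ^ 2 = y) (r i : Fin n) :
    ∑ j : Fin n, kacM ℂ n y i j * kacV z (n - 1 - r) r j =
      ((n : ℂ) - 1 - 2 * (r : ℕ)) * z * kacV z (n - 1 - r) r i := by
  have hr := r.2
  have hi := i.2
  have hn : ((n - 1 - r : ℕ) : ℂ) = (n : ℂ) - 1 - (r : ℕ) := by
    rw [Nat.cast_sub (by omega), Nat.cast_sub (by omega)]; simp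
  have hb := kacV_big z (n - 1 - r) r
  rw [show n - 1 - (r : ℕ) + r + 1 = n by omega] at hb
  rw [kacM_sum n y _ hb]
  obtain ⟨i, hi'⟩ := i
  cases i with
  | zero =>
    have := kacV_one z (n - 1 - r) r
    rw [hn] at this
    simp
    linear_combination this
  | succ k =>
    have := kacV_succ z (n - 1 - r) r k
    rw [hn] at this
    have e : ((n - (k + 1) : ℕ) : ℂ) = n - (k + 1) := by
      rw [Nat.cast_sub (by omega)]; simp
    simp only [Nat.add_eq_zero_iff, one_ne_zero, and_false, if_false, e, Nat.add_sub_cancel]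
    subst hz
    push_cast
    linear_combination this

lemma kac2M_split (n1 n2 : ℕ) (x y : ℂ) (p q : Fin n1 × Fin n2) :
    kac2M ℂ n1 n2 x y p q = (if p.1 = q.1 then kacM ℂ n2 y p.2 q.2 else 0)
      + (if p.2 = q.2 then kacM ℂ n1 x p.1 q.1 else 0) := by
  simp only [kac2M, kacM, Matrix.of_apply]
  by_cases h : p.1 = q.1
  · simp [h]
  · by_cases h' : p.2 = q.2 <;> simp [h, h']

/-- the eigenvectors -/
def kacW (n1 n2 : ℕ) (z1 z2 : ℂ) (s p : Fin n1 × Fin n2) : ℂ :=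
  kacV z1 (n1 - 1 - s.1) s.1 p.1 * kacV z2 (n2 - 1 - s.2) s.2 p.2

/-- the eigenvalues -/
def kacD (n1 n2 : ℕ) (z1 z2 : ℂ) (s : Fin n1 × Fin n2) : ℂ :=
  ((n1 : ℂ) - 1 - 2 * (s.1 : ℕ)) * z1 + ((n2 : ℂ) - 1 - 2 * (s.2 : ℕ)) * z2

lemma kac2_eig (n1 n2 : ℕ) (x y z1 z2 : ℂ) (hz1 : z1 ^ 2 = x) (hz2 : z2 ^ 2 = y)
    (s : Fin n1 × Fin n2) :
    kac2M ℂ n1 n2 x y *ᵥ kacW n1 n2 z1 z2 s = kacD n1 n2 z1 z2 s • kacW n1 n2 z1 z2 s := by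
  funext p
  have e1 := kacM_eig n1 x z1 hz1 s.1 p.1
  have e2 := kacM_eig n2 y z2 hz2 s.2 p.2
  simp only [Matrix.mulVec, dotProduct, kac2M_split, add_mul, Finset.sum_add_distrib,
    Pi.smul_apply, smul_eq_mul]
  rw [Fintype.sum_prod_type, Fintype.sum_prod_type]
  simp only [ite_mul, zero_mul, kacW, kacD]
  rw [Finset.sum_eq_single p.1 (fun b _ hb => by simp [Ne.symm hb]) (by simp)]
  simp only [if_true, Finset.sum_ite_eq, Finset.mem_univ]
  have f1 : ∀ j : Fin n2, kacM ℂ n2 y p.2 j *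
      (kacV z1 (n1 - 1 - s.1) s.1 p.1 * kacV z2 (n2 - 1 - s.2) s.2 j) =
      kacV z1 (n1 - 1 - s.1) s.1 p.1 *
        (kacM ℂ n2 y p.2 j * kacV z2 (n2 - 1 - s.2) s.2 j) := fun j => by ring
  simp only [f1, ← mul_assoc (kacM ℂ n1 x p.1 _)]
  rw [← Finset.mul_sum, ← Finset.sum_mul, e1, e2]
  ring

lemma kac_rank_map {m : Type*} [Fintype m] [DecidableEq m] (M : Matrix m m ℝ) :
    (M.map (algebraMap ℝ ℂ)).rank = M.rank := by
  classical
  obtain ⟨V, U, e, hV, hU, h⟩ := Matrix.exists_rank_normal_form M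
  rw [← diagonal_one, ← diagonal_zero, fromBlocks_diagonal, submatrix_diagonal_equiv] at h
  have hV' := (Matrix.isUnit_iff_isUnit_det _).1 (hV.map (algebraMap ℝ ℂ).mapMatrix)
  have hU' := (Matrix.isUnit_iff_isUnit_det _).1 (hU.map (algebraMap ℝ ℂ).mapMatrix)
  rw [Matrix.isUnit_iff_isUnit_det] at hV hU
  have h2 := congrArg (algebraMap ℝ ℂ).mapMatrix h
  rw [map_mul, map_mul] at h2
  have r1 := congrArg Matrix.rank h
  have r2 := congrArg Matrix.rank h2
  rw [rank_mul_eq_left_of_isUnit_det _ _ hU, rank_mul_eq_right_of_isUnit_det _ _ hV,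
    rank_diagonal] at r1
  rw [rank_mul_eq_left_of_isUnit_det _ _ hU', rank_mul_eq_right_of_isUnit_det _ _ hV',
    RingHom.mapMatrix_apply, RingHom.mapMatrix_apply, diagonal_map (map_zero _),
    rank_diagonal] at r2
  refine r2.trans (Eq.trans ?_ r1.symm)
  exact Fintype.card_congr (Equiv.subtypeEquivRight fun i => by simp)

/-- If `x ≠ y` are real, `z1² = x`, `z2² = y` and `(z1,z2)` is
`(n1,n2)`-independent, then `rank K(n1,n2,x,y) = n1·n2` if `n1·n2` is even and
`= n1·n2 - 1` if `n1·n2` is odd; in particular `K(n1,n2,x,y)` is nonsingular iff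
`n1·n2` is even. -/
theorem kac2_rank (n1 n2 : ℕ) (h1 : 2 ≤ n1) (h2 : 2 ≤ n2)
    (x y : ℝ) (hxy : x ≠ y) (z1 z2 : ℂ) (hz1 : z1 ^ 2 = (x : ℂ)) (hz2 : z2 ^ 2 = (y : ℂ))
    (hind : IndepPair n1 n2 z1 z2) :
    (kac2M ℝ n1 n2 x y).rank = (if Even (n1 * n2) then n1 * n2 else n1 * n2 - 1) ∧
      ((kac2M ℝ n1 n2 x y).det ≠ 0 ↔ Even (n1 * n2)) := by
  classical
  have hinj : Function.Injective (kacD n1 n2 z1 z2) := by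
    intro s t hst
    have := hind _ _ _ _ ⟨s.1, s.1.2, rfl⟩ ⟨t.1, t.1.2, rfl⟩ ⟨s.2, s.2.2, rfl⟩ ⟨t.2, t.2.2, rfl⟩
      (by
        unfold kacD at hst
        push_cast
        linear_combination hst)
    ext <;> omega
  have hzero : ∀ s : Fin n1 × Fin n2, kacD n1 n2 z1 z2 s = 0 ↔
      (n1 = 2 * (s.1 : ℕ) + 1 ∧ n2 = 2 * (s.2 : ℕ) + 1) := by
    intro s
    have l1 := s.1.2
    have l2 := s.2.2
    constructor
    · intro hs
      have c1 : ((n1 - 1 - s.1 : ℕ) : ℤ) = n1 - 1 - (s.1 : ℕ) := by omega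
      have c2 : ((n2 - 1 - s.2 : ℕ) : ℤ) = n2 - 1 - (s.2 : ℕ) := by omega
      have := hind _ _ _ _ ⟨s.1, s.1.2, rfl⟩ ⟨n1 - 1 - s.1, by omega, rfl⟩
        ⟨s.2, s.2.2, rfl⟩ ⟨n2 - 1 - s.2, by omega, rfl⟩
        (by
          unfold kacD at hs
          rw [c1, c2]
          push_cast
          linear_combination 2 * hs)
      omega
    · rintro ⟨e1, e2⟩
      have e1' : (n1 : ℂ) = 2 * (s.1 : ℕ) + 1 := by exact_mod_cast e1
      have e2' : (n2 : ℂ) = 2 * (s.2 : ℕ) + 1 := by exact_mod_cast e2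
      unfold kacD
      rw [e1', e2']
      ring
  have hmap : (kac2M ℝ n1 n2 x y).map (algebraMap ℝ ℂ) = kac2M ℂ n1 n2 x y := by
    ext p q
    simp only [kac2M, kacM, Matrix.map_apply, Matrix.of_apply]
    split_ifs <;> simp
  have heig := kac2_eig n1 n2 x y z1 z2 hz1 hz2
  have hne : ∀ s, kacW n1 n2 z1 z2 s ≠ 0 := by
    intro s hs
    have := congrFun hs (⟨0, by omega⟩, ⟨0, by omega⟩)
    simp [kacW, kacV_zero] at this
  have hli : LinearIndependent ℂ (kacW n1 n2 z1 z2) := by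
    apply Module.End.eigenvectors_linearIndependent' (Matrix.toLin' (kac2M ℂ n1 n2 x y))
      (kacD n1 n2 z1 z2) hinj
    intro s
    rw [Module.End.hasEigenvector_iff, Module.End.mem_eigenspace_iff]
    exact ⟨by rw [Matrix.toLin'_apply]; exact heig s, hne s⟩
  set P : Matrix (Fin n1 × Fin n2) (Fin n1 × Fin n2) ℂ :=
    (Matrix.of (kacW n1 n2 z1 z2))ᵀ with hP
  have hPu : IsUnit P := by
    rw [← Matrix.linearIndependent_cols_iff_isUnit]
    exact hli
  have hPd : IsUnit P.det := (Matrix.isUnit_iff_isUnit_det _).1 hPu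
  have hMP : kac2M ℂ n1 n2 x y * P = P * Matrix.diagonal (kacD n1 n2 z1 z2) := by
    ext p s
    have := congrFun (heig s) p
    rw [Matrix.mul_diagonal]
    simp only [Pi.smul_apply, smul_eq_mul] at this
    rw [mul_comm]
    exact this
  have hrank : (kac2M ℝ n1 n2 x y).rank =
      Fintype.card {s // kacD n1 n2 z1 z2 s ≠ 0} := by
    rw [← kac_rank_map, hmap, ← Matrix.rank_diagonal,
      ← Matrix.rank_mul_eq_left_of_isUnit_det P _ hPd, hMP,
      Matrix.rank_mul_eq_right_of_isUnit_det P _ hPd]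
  have hdet : (kac2M ℝ n1 n2 x y).det ≠ 0 ↔ ∀ s, kacD n1 n2 z1 z2 s ≠ 0 := by
    have h := congrArg Matrix.det hMP
    rw [Matrix.det_mul, Matrix.det_mul, mul_comm, Matrix.det_diagonal] at h
    have h' := mul_left_cancel₀ hPd.ne_zero h
    rw [← hmap, ← RingHom.mapMatrix_apply, ← RingHom.map_det] at h'
    rw [← (algebraMap ℝ ℂ).injective.ne_iff, h', map_zero, Finset.prod_ne_zero_iff]
    simp
  by_cases hE : Even (n1 * n2)
  · have hall : ∀ s, kacD n1 n2 z1 z2 s ≠ 0 := by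
      intro s hs
      obtain ⟨e1, e2⟩ := (hzero s).1 hs
      rw [← Nat.not_odd_iff_even] at hE
      exact hE (Nat.odd_mul.2 ⟨⟨_, e1⟩, ⟨_, e2⟩⟩)
    refine ⟨?_, by simp [hE, hdet, hall]⟩
    rw [hrank, if_pos hE, Fintype.card_subtype, Finset.filter_true_of_mem (fun s _ => hall s)]
    simp
  · obtain ⟨⟨k, hk⟩, ⟨l, hl⟩⟩ := Nat.odd_mul.1 (Nat.not_even_iff_odd.1 hE)
    have hiff : ∀ s, kacD n1 n2 z1 z2 s ≠ 0 ↔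
        s ≠ ((⟨k, by omega⟩, ⟨l, by omega⟩) : Fin n1 × Fin n2) := by
      intro s
      rw [Ne, hzero, Ne, Prod.ext_iff, Fin.ext_iff, Fin.ext_iff]
      simp only
      omega
    refine ⟨?_, ?_⟩
    · rw [hrank, if_neg hE, Fintype.card_congr (Equiv.subtypeEquivRight hiff),
        Fintype.card_subtype_compl, Fintype.card_subtype_eq]
      simp
    · simp only [hE, iff_false, hdet]
      intro h
      exact (hiff _).1 (h _) rfl
end
end

section
/- Let n1, n2 ≥ 2 be integers, τ1, τ2 ∈ ℝ, and let s1, c1, s2, c2 : ℝ → ℝ be differentiable functions satisfying s_i' = c_i and c_i' = τ_i·s_i for i = 1,2. Let α = (α_{u,v}) and β = (β_{u,v}) be real numbers indexed by 0 ≤ u ≤ n1−1, 0 ≤ v ≤ n2−1, and define F(r) = Σ_{u,v} (α_{u,v} + r·β_{u,v}) · c1(r)^{n1−1−u} s1(r)^u c2(r)^{n2−1−v} s2(r)^v. Then F'(r) = Σ_{u,v} (α'_{u,v} + r·β'_{u,v}) · c1(r)^{n1−1−u} s1(r)^u c2(r)^{n2−1−v} s2(r)^v for all r ∈ ℝ,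 where, regarding α and β as column vectors in ℝ^{n1·n2} with the index (u,v) placed at position u·n2 + v + 1, the new coefficient vectors are α' = K(n1,n2,τ1,τ2)·α + β and β' = K(n1,n2,τ1,τ2)·β; equivalently, the stacked vector (α',β') equals Q(n1,n2,τ1,τ2) applied to the stacked vector (α,β). -/
open Matrix Kronecker

noncomputable section

lemma fin_sum_ite (n k : ℕ) (f : ℕ → ℝ) :
    (∑ i : Fin n, if (i : ℕ) = k then f i else 0) = if k < n then f k else 0 := by
  rw [Fin.sum_univ_eq_sum_range (fun i => if i = k then f i else 0) n, Finset.sum_ite_eq']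
  simp

lemma kac_deriv (n : ℕ) (τ : ℝ) (s c : ℝ → ℝ) (r : ℝ)
    (hs : HasDerivAt s (c r) r) (hc : HasDerivAt c (τ * s r) r) (j : Fin n) :
    HasDerivAt (fun r => c r ^ (n - 1 - (j : ℕ)) * s r ^ (j : ℕ))
      (∑ i : Fin n, kacM ℝ n τ i j * (c r ^ (n - 1 - (i : ℕ)) * s r ^ (i : ℕ))) r := by
  have h := (hc.fun_pow (n - 1 - (j : ℕ))).mul (hs.fun_pow (j : ℕ))
  refine h.congr_deriv ?_
  have e : ∀ i : Fin n, kacM ℝ n τ i j * (c r ^ (n - 1 - (i : ℕ)) * s r ^ (i : ℕ)) =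
      (if (i : ℕ) = (j : ℕ) + 1 then
        (fun i : ℕ => ((n - 1 - (j : ℕ) : ℕ) : ℝ) * τ * (c r ^ (n - 1 - i) * s r ^ i)) i else 0) +
      (if (i : ℕ) = (j : ℕ) - 1 then
        (fun i : ℕ => ((j : ℕ) : ℝ) * (c r ^ (n - 1 - i) * s r ^ i)) i else 0) := by
    intro i
    simp only [kacM, Matrix.of_apply]
    by_cases h1 : (i : ℕ) = (j : ℕ) + 1
    · have h2 : ¬ ((i : ℕ) = (j : ℕ) - 1) := by omega
      rw [if_pos h1, if_pos h1, if_neg h2, add_zero]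
    · rw [if_neg h1, if_neg h1, zero_add]
      by_cases h2 : (j : ℕ) = (i : ℕ) + 1
      · have h3 : (i : ℕ) = (j : ℕ) - 1 := by omega
        rw [if_pos h2, if_pos h3, h2]
      · rw [if_neg h2]
        by_cases h3 : (i : ℕ) = (j : ℕ) - 1
        · have h4 : (j : ℕ) = 0 := by omega
          rw [if_pos h3, h4]; simp
        · rw [if_neg h3]; simp
  rw [Finset.sum_congr rfl (fun i _ => e i), Finset.sum_add_distrib,
    fin_sum_ite n ((j : ℕ) + 1)
      (fun i : ℕ => ((n - 1 - (j : ℕ) : ℕ) : ℝ) * τ * (c r ^ (n - 1 - i) * s r ^ i)),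
    fin_sum_ite n ((j : ℕ) - 1)
      (fun i : ℕ => ((j : ℕ) : ℝ) * (c r ^ (n - 1 - i) * s r ^ i))]
  have hj := j.2
  rw [if_pos (show (j : ℕ) - 1 < n by omega)]
  congr 1
  · split_ifs with h1
    · rw [show n - 1 - ((j : ℕ) + 1) = n - 1 - (j : ℕ) - 1 by omega]; ring
    · rw [show n - 1 - (j : ℕ) = 0 by omega]; simp
  · rcases Nat.eq_zero_or_pos (j : ℕ) with h0 | h0
    · rw [h0]; simp
    · rw [show n - 1 - ((j : ℕ) - 1) = n - 1 - (j : ℕ) + 1 by omega]; ring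

lemma kac2M_apply (n1 n2 : ℕ) (x y : ℝ) (p q : Fin n1 × Fin n2) :
    kac2M ℝ n1 n2 x y p q = (if p.2 = q.2 then kacM ℝ n1 x p.1 q.1 else 0) +
      (if p.1 = q.1 then kacM ℝ n2 y p.2 q.2 else 0) := by
  simp only [kac2M, Matrix.of_apply]
  by_cases h : p.1 = q.1
  · simp [h, kacM]
  · simp only [h, if_false, kacM, Matrix.of_apply]
    split_ifs <;> simp

/-- If `s_i' = c_i` and `c_i' = τ_i·s_i` (`i = 1,2`) and
`F(r) = Σ_{u,v} (α_{u,v} + r·β_{u,v})·c1^{n1-1-u} s1^u c2^{n2-1-v} s2^v`, then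
`F'(r) = Σ_{u,v} (α'_{u,v} + r·β'_{u,v})·c1^{n1-1-u} s1^u c2^{n2-1-v} s2^v`, where
(viewing `α, β` as vectors in `ℝ^{n1·n2}` with `(u,v)` at position `u·n2+v+1`)
`α' = K(n1,n2,τ1,τ2)·α + β` and `β' = K(n1,n2,τ1,τ2)·β`, i.e. `(α',β') = Q·(α,β)`. -/
theorem deriv_parallel_family (n1 n2 : ℕ) (h1 : 2 ≤ n1) (h2 : 2 ≤ n2) (τ1 τ2 : ℝ)
    (s1 c1 s2 c2 : ℝ → ℝ)
    (hs1 : ∀ r, HasDerivAt s1 (c1 r) r) (hc1 : ∀ r, HasDerivAt c1 (τ1 * s1 r) r)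
    (hs2 : ∀ r, HasDerivAt s2 (c2 r) r) (hc2 : ∀ r, HasDerivAt c2 (τ2 * s2 r) r)
    (α β : Fin n1 × Fin n2 → ℝ) (r : ℝ) :
    HasDerivAt (fun r => ∑ p : Fin n1 × Fin n2,
        (α p + r * β p) *
          (c1 r ^ (n1 - 1 - (p.1 : ℕ)) * s1 r ^ (p.1 : ℕ) *
            (c2 r ^ (n2 - 1 - (p.2 : ℕ)) * s2 r ^ (p.2 : ℕ))))
      (∑ p : Fin n1 × Fin n2,
        (((kac2M ℝ n1 n2 τ1 τ2).mulVec α + β) p +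
            r * (kac2M ℝ n1 n2 τ1 τ2).mulVec β p) *
          (c1 r ^ (n1 - 1 - (p.1 : ℕ)) * s1 r ^ (p.1 : ℕ) *
            (c2 r ^ (n2 - 1 - (p.2 : ℕ)) * s2 r ^ (p.2 : ℕ)))) r := by
  have hm : ∀ q : Fin n1 × Fin n2, HasDerivAt (fun r =>
      c1 r ^ (n1 - 1 - (q.1 : ℕ)) * s1 r ^ (q.1 : ℕ) *
            (c2 r ^ (n2 - 1 - (q.2 : ℕ)) * s2 r ^ (q.2 : ℕ)))
      (∑ p : Fin n1 × Fin n2, kac2M ℝ n1 n2 τ1 τ2 p q *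
        (c1 r ^ (n1 - 1 - (p.1 : ℕ)) * s1 r ^ (p.1 : ℕ) *
            (c2 r ^ (n2 - 1 - (p.2 : ℕ)) * s2 r ^ (p.2 : ℕ)))) r := by
    intro q
    refine ((kac_deriv n1 τ1 s1 c1 r (hs1 r) (hc1 r) q.1).mul
      (kac_deriv n2 τ2 s2 c2 r (hs2 r) (hc2 r) q.2)).congr_deriv ?_
    simp only [kac2M_apply, add_mul, Finset.sum_add_distrib]
    congr 1
    · rw [Fintype.sum_prod_type, Finset.sum_mul]
      refine Finset.sum_congr rfl fun i _ => ?_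
      simp only [ite_mul, zero_mul, Finset.sum_ite_eq', Finset.mem_univ, if_true]
      ring
    · rw [Fintype.sum_prod_type_right, Finset.mul_sum]
      refine Finset.sum_congr rfl fun i _ => ?_
      simp only [ite_mul, zero_mul, Finset.sum_ite_eq', Finset.mem_univ, if_true]
      ring
  have hF := HasDerivAt.fun_sum (u := Finset.univ) (fun (q : Fin n1 × Fin n2) _ =>
    ((((hasDerivAt_id' r).mul_const (β q)).const_add (α q)).fun_mul (hm q)))
  refine hF.congr_deriv ?_
  simp only [Pi.add_apply, Matrix.mulVec, dotProduct]
  rw [Finset.sum_add_distrib]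
  simp only [Finset.mul_sum]
  rw [Finset.sum_comm (s := Finset.univ) (t := Finset.univ), ← Finset.sum_add_distrib]
  refine Finset.sum_congr rfl fun p _ => ?_
  rw [add_right_comm, add_mul, ← Finset.sum_add_distrib, Finset.sum_mul, add_comm, one_mul]
  congr 1
  refine Finset.sum_congr rfl fun q _ => ?_
  ring
end
end
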